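/- arXiv:2509.01176 — 4 statements merged into one kernel-verified Lean document; each statement's English description precedes it below -/
import Mathlib

section
/- Let Ω ⊆ ℝⁿ be open and let φ : ℝⁿ → ℝ be twice continuously differentiable on Ω. Let f : ℝ → ℝ be smooth with f'(t) ≠ 0 for all t ∈ ℝ, and let G : (0,∞) → ℝ be twice differentiable and satisfy G''(e^{f(t)}) = e^{−2f(t)}/f'(t)² for every t ∈ ℝ. Define the open set U := {(y, s) ∈ ℝⁿ × ℝ : s > 0 and y/s ∈ Ω} and φ̂ : U → ℝ by φ̂(y, s) := s·φ(y/s) + G(s), and define Ψ : Ω × ℝ → ℝⁿ × ℝ by Ψ(x, t) := (e^{f(t)}·x, e^{f(t)}). Then for every (x,t) ∈ Ω × ℝ and all tangent vectors (v, a), (w, b) ∈ ℝⁿ × ℝ one has D²φ̂(Ψ(x,t))( DΨ(x,t)(v,a), DΨ(x,t)(w,b) ) = a·b + e^{f(t)}·D²φ(x)(v, w). (This is the coordinate-free form of the warped-product theorem: the Hessian form of φ̂ in the coordinates y₁,…,yₙ,y pulls back to dt² + e^{f}·Hess(φ).) -/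
section WarpedProduct

variable {E : Type*} [NormedAddCommGroup E] [NormedSpace ℝ E]

/-- The derivative of the projection `(y, s) ↦ s⁻¹ • y`. -/
lemma hasFDerivAt_inv_smul_fst (p : E × ℝ) (hp : p.2 ≠ 0) :
    HasFDerivAt (fun q : E × ℝ => q.2⁻¹ • q.1)
      (p.2⁻¹ • (ContinuousLinearMap.fst ℝ E ℝ
        - (ContinuousLinearMap.snd ℝ E ℝ).smulRight (p.2⁻¹ • p.1))) p := by
  have h1 : HasFDerivAt (fun q : E × ℝ => q.2⁻¹)
      (-(p.2 ^ 2)⁻¹ • ContinuousLinearMap.snd ℝ E ℝ) p :=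
    (hasDerivAt_inv hp).comp_hasFDerivAt p hasFDerivAt_snd
  refine (h1.smul hasFDerivAt_fst).congr_fderiv ?_
  refine ContinuousLinearMap.ext fun v => ?_
  simp only [add_apply, smul_apply,
    sub_apply, ContinuousLinearMap.smulRight_apply,
    ContinuousLinearMap.coe_fst', ContinuousLinearMap.coe_snd', smul_eq_mul]
  module

/-- The derivative of `(y, s) ↦ s φ(y/s) + G(s)`. -/
lemma hasFDerivAt_perspective_add {φ : E → ℝ} {G : ℝ → ℝ} {p : E × ℝ} (hp : p.2 ≠ 0)
    (hφ : DifferentiableAt ℝ φ (p.2⁻¹ • p.1)) (hG : DifferentiableAt ℝ G p.2) :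
    HasFDerivAt (fun q : E × ℝ => q.2 * φ (q.2⁻¹ • q.1) + G q.2)
      ((fderiv ℝ φ (p.2⁻¹ • p.1)).comp (ContinuousLinearMap.fst ℝ E ℝ)
        + (φ (p.2⁻¹ • p.1) - fderiv ℝ φ (p.2⁻¹ • p.1) (p.2⁻¹ • p.1) + deriv G p.2) •
          ContinuousLinearMap.snd ℝ E ℝ) p := by
  have h1 : HasFDerivAt (fun q : E × ℝ => φ (q.2⁻¹ • q.1)) _ p :=
    hφ.hasFDerivAt.comp p (hasFDerivAt_inv_smul_fst p hp)
  have h2 : HasFDerivAt (fun q : E × ℝ => G q.2)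
      (deriv G p.2 • ContinuousLinearMap.snd ℝ E ℝ) p :=
    hG.hasDerivAt.comp_hasFDerivAt p hasFDerivAt_snd
  refine ((hasFDerivAt_snd.mul h1).add h2).congr_fderiv ?_
  refine ContinuousLinearMap.ext fun v => ?_
  simp only [add_apply, smul_apply,
    sub_apply, ContinuousLinearMap.smulRight_apply,
    ContinuousLinearMap.comp_apply, map_sub, map_smul,
    ContinuousLinearMap.coe_fst', ContinuousLinearMap.coe_snd', smul_eq_mul]
  field_simp
  ring

/-- The Hessian of `(y, s) ↦ s φ(y/s) + G(s)`. -/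
lemma fderiv_fderiv_perspective_add {Ω : Set E} (hΩ : IsOpen Ω) {φ : E → ℝ}
    (hφ : ContDiffOn ℝ 2 φ Ω) {G : ℝ → ℝ} (hG : ∀ s : ℝ, 0 < s → DifferentiableAt ℝ G s)
    {p : E × ℝ} (hp : 0 < p.2) (hpΩ : p.2⁻¹ • p.1 ∈ Ω)
    (hG' : DifferentiableAt ℝ (deriv G) p.2) (v w : E × ℝ) :
    fderiv ℝ (fderiv ℝ (fun q : E × ℝ => q.2 * φ (q.2⁻¹ • q.1) + G q.2)) p v w =
      p.2⁻¹ * fderiv ℝ (fderiv ℝ φ) (p.2⁻¹ • p.1)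
        (v.1 - v.2 • p.2⁻¹ • p.1) (w.1 - w.2 • p.2⁻¹ • p.1)
      + deriv (deriv G) p.2 * v.2 * w.2 := by
  have hu := hasFDerivAt_inv_smul_fst p hp.ne'
  have hev : fderiv ℝ (fun q : E × ℝ => q.2 * φ (q.2⁻¹ • q.1) + G q.2) =ᶠ[nhds p]
      fun q => (fderiv ℝ φ (q.2⁻¹ • q.1)).comp (ContinuousLinearMap.fst ℝ E ℝ)
        + (φ (q.2⁻¹ • q.1) - fderiv ℝ φ (q.2⁻¹ • q.1) (q.2⁻¹ • q.1) + deriv G q.2) •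
          ContinuousLinearMap.snd ℝ E ℝ := by
    filter_upwards [hu.continuousAt.preimage_mem_nhds (hΩ.mem_nhds hpΩ),
      continuous_snd.continuousAt.preimage_mem_nhds (Ioi_mem_nhds hp)] with q hq1 hq2
    exact (hasFDerivAt_perspective_add (ne_of_gt hq2)
      ((hφ.contDiffAt (hΩ.mem_nhds hq1)).differentiableAt (by norm_num)) (hG _ hq2)).fderiv
  have hφp := hφ.contDiffAt (hΩ.mem_nhds hpΩ)
  have h0 : HasFDerivAt (fun q : E × ℝ => φ (q.2⁻¹ • q.1)) _ p :=
    (hφp.differentiableAt (by norm_num)).hasFDerivAt.comp p hu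
  have h1 : HasFDerivAt (fun q : E × ℝ => fderiv ℝ φ (q.2⁻¹ • q.1)) _ p :=
    ((hφp.fderiv_right (m := 1) (by norm_num)).differentiableAt
      (by norm_num)).hasFDerivAt.comp p hu
  have h2 : HasFDerivAt (fun q : E × ℝ => deriv G q.2)
      (deriv (deriv G) p.2 • ContinuousLinearMap.snd ℝ E ℝ) p :=
    hG'.hasDerivAt.comp_hasFDerivAt p hasFDerivAt_snd
  have h3 := (h1.clm_comp (hasFDerivAt_const (ContinuousLinearMap.fst ℝ E ℝ) p)).add
    (((h0.sub (h1.clm_apply hu)).add h2).smul_const (ContinuousLinearMap.snd ℝ E ℝ))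
  have h4 := (h3.congr_of_eventuallyEq hev).fderiv
  rw [h4]
  simp only [add_apply, smul_apply,
    sub_apply, ContinuousLinearMap.smulRight_apply,
    ContinuousLinearMap.comp_apply, map_sub, map_smul, ContinuousLinearMap.compL_apply,
    ContinuousLinearMap.flip_apply, zero_apply, map_zero,
    ContinuousLinearMap.coe_fst', ContinuousLinearMap.coe_snd', smul_eq_mul]
  ring

/-- The derivative of `(x, t) ↦ (r(t) x, r(t))`. -/
lemma hasFDerivAt_smul_prodMk {r : ℝ → ℝ} {r' t : ℝ} (hr : HasDerivAt r r' t) (x : E) :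
    HasFDerivAt (fun q : E × ℝ => (r q.2 • q.1, r q.2))
      ((r t • ContinuousLinearMap.fst ℝ E ℝ
        + (r' • ContinuousLinearMap.snd ℝ E ℝ).smulRight x).prod
          (r' • ContinuousLinearMap.snd ℝ E ℝ)) (x, t) := by
  have h : HasFDerivAt (fun q : E × ℝ => r q.2) (r' • ContinuousLinearMap.snd ℝ E ℝ) (x, t) :=
    HasDerivAt.comp_hasFDerivAt (x, t) hr hasFDerivAt_snd
  exact (h.smul hasFDerivAt_fst).prodMk h

end WarpedProduct

/-- Warped-product construction of Hessian metrics: the Hessian form of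
`φ̂(y,s) = s·φ(y/s) + G(s)` pulled back along `Ψ(x,t) = (e^{f t}·x, e^{f t})`
is `dt² + e^{f}·Hess(φ)`. -/
theorem stmt1 {n : ℕ} (Ω : Set (Fin n → ℝ)) (hΩ : IsOpen Ω)
    (φ : (Fin n → ℝ) → ℝ) (hφ : ContDiffOn ℝ 2 φ Ω)
    (f : ℝ → ℝ) (hf : ContDiff ℝ (⊤ : ℕ∞) f) (hf' : ∀ t : ℝ, deriv f t ≠ 0)
    (G : ℝ → ℝ) (hG : ∀ s : ℝ, 0 < s → DifferentiableAt ℝ G s)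
    (hG' : ∀ s : ℝ, 0 < s → DifferentiableAt ℝ (deriv G) s)
    (hG'' : ∀ t : ℝ, deriv (deriv G) (Real.exp (f t)) = Real.exp (-(2 * f t)) / (deriv f t) ^ 2)
    (φhat : (Fin n → ℝ) × ℝ → ℝ)
    (hφhat : ∀ p : (Fin n → ℝ) × ℝ, φhat p = p.2 * φ (p.2⁻¹ • p.1) + G p.2)
    (Ψ : (Fin n → ℝ) × ℝ → (Fin n → ℝ) × ℝ)
    (hΨ : ∀ q : (Fin n → ℝ) × ℝ, Ψ q = (Real.exp (f q.2) • q.1, Real.exp (f q.2))) :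
    ∀ x ∈ Ω, ∀ (t : ℝ) (v w : Fin n → ℝ) (a b : ℝ),
      fderiv ℝ (fderiv ℝ φhat) (Ψ (x, t)) (fderiv ℝ Ψ (x, t) (v, a)) (fderiv ℝ Ψ (x, t) (w, b))
        = a * b + Real.exp (f t) * fderiv ℝ (fderiv ℝ φ) x v w := by
  intro x hx t v w a b
  obtain rfl : φhat = fun p => p.2 * φ (p.2⁻¹ • p.1) + G p.2 := funext hφhat
  obtain rfl : Ψ = fun q => (Real.exp (f q.2) • q.1, Real.exp (f q.2)) := funext hΨ
  have hs : 0 < Real.exp (f t) := Real.exp_pos _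
  have hr : HasDerivAt (fun t => Real.exp (f t)) (Real.exp (f t) * deriv f t) t :=
    ((hf.differentiable (by simp)) t).hasDerivAt.exp
  have hu : (Real.exp (f t))⁻¹ • Real.exp (f t) • x = x := inv_smul_smul₀ hs.ne' x
  have hw (c : ℝ) (z : Fin n → ℝ) : Real.exp (f t) • z + (Real.exp (f t) * deriv f t * c) • x
      - (Real.exp (f t) * deriv f t * c) • x = Real.exp (f t) • z := add_sub_cancel_right _ _
  rw [(hasFDerivAt_smul_prodMk hr x).fderiv,
    fderiv_fderiv_perspective_add hΩ hφ hG hs (by rwa [hu]) (hG' _ hs)]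
  simp only [ContinuousLinearMap.prod_apply, add_apply,
    smul_apply, ContinuousLinearMap.smulRight_apply,
    ContinuousLinearMap.coe_fst', ContinuousLinearMap.coe_snd', smul_eq_mul, hu, hw, map_smul, hG'']
  have he : Real.exp (-(2 * f t)) = (Real.exp (f t) ^ 2)⁻¹ := by
    rw [Real.exp_neg, two_mul, Real.exp_add, sq]
  have := hf' t
  rw [he]
  field_simp
  ring
end

section
/- Let n ≥ 2, let ℍⁿ := {x ∈ ℝⁿ : xₙ > 0} be the upper half space, and define Ψ : ℍⁿ → ℝⁿ by Ψ(x) := (2x₁/xₙ², …, 2x_{n−1}/xₙ², 1/xₙ²), and φ : {y ∈ ℝⁿ : yₙ > 0} → ℝ by φ(y) := (y₁² + ⋯ + y_{n−1}²)/(8yₙ) − (1/4)·log(yₙ). Then for every x ∈ ℍⁿ and all vectors v, w ∈ ℝⁿ, D²φ(Ψ(x))( DΨ(x)v, DΨ(x)w ) = ⟨v, w⟩/xₙ², where ⟨·,·⟩ is the standard Euclidean inner product. (That is, the Hessian quadratic form of φ in the coordinates y₁,…,yₙ is precisely the hyperbolic metric (dx₁² + ⋯ + dxₙ²)/xₙ²;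 in particular the hyperbolic metric is a Hessian metric.) -/
section HessianPotential

variable {m : ℕ}

/-- The Hessian potential `(y₁² + ⋯ + y_{n−1}²)/(8yₙ) − (1/4)·log yₙ` of the hyperbolic metric. -/
noncomputable def hyperbolicPotential (y : Fin (m + 1) → ℝ) : ℝ :=
  ∑ i : Fin m, y i.castSucc ^ 2 / (8 * y (Fin.last m)) - 1 / 4 * Real.log (y (Fin.last m))

/-- The affine coordinates `2xᵢ/xₙ²` (for `i < n`) and `1/xₙ²` on the upper half space. -/
noncomputable def hyperbolicAffineCoord (x : Fin (m + 1) → ℝ) (i : Fin (m + 1)) : ℝ :=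
  if i = Fin.last m then 1 / x (Fin.last m) ^ 2 else 2 * x i / x (Fin.last m) ^ 2

lemma hasDerivAt_apply_add_smul {ι : Type*} (y a : ι → ℝ) (i : ι) :
    HasDerivAt (fun s : ℝ => (y + s • a) i) (a i) 0 := by
  simpa using ((hasDerivAt_id (0 : ℝ)).mul_const (a i)).const_add (y i)

lemma contDiffAt_hyperbolicPotential {y : Fin (m + 1) → ℝ} (hy : 0 < y (Fin.last m)) :
    ContDiffAt ℝ 2 hyperbolicPotential y := by
  have h : ∀ i, ContDiffAt ℝ 2 (fun z : Fin (m + 1) → ℝ => z i) y :=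
    fun i => (contDiff_apply ℝ ℝ i).contDiffAt
  unfold hyperbolicPotential
  refine ContDiffAt.sub (ContDiffAt.sum fun i _ => ?_) ?_
  · exact ((h _).pow 2).div (contDiffAt_const.mul (h _)) (by positivity)
  · exact contDiffAt_const.mul ((h _).log hy.ne')

lemma fderiv_hyperbolicPotential_apply {y : Fin (m + 1) → ℝ} (hy : 0 < y (Fin.last m))
    (b : Fin (m + 1) → ℝ) :
    fderiv ℝ hyperbolicPotential y b =
      ∑ i : Fin m, (y i.castSucc * b i.castSucc / (4 * y (Fin.last m))
        - y i.castSucc ^ 2 * b (Fin.last m) / (8 * y (Fin.last m) ^ 2))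
        - b (Fin.last m) / (4 * y (Fin.last m)) := by
  have hd := (contDiffAt_hyperbolicPotential hy).differentiableAt (by norm_num)
  rw [← hd.lineDeriv_eq_fderiv]
  refine HasDerivAt.deriv ?_
  have h := hasDerivAt_apply_add_smul y b
  have hy0 : (y + (0 : ℝ) • b) (Fin.last m) ≠ 0 := by simpa using hy.ne'
  refine HasDerivAt.sub (HasDerivAt.fun_sum fun i _ => ?_) ?_
  · refine HasDerivAt.congr_deriv
      (((h i.castSucc).fun_pow 2).fun_div ((h (Fin.last m)).const_mul 8)
      (mul_ne_zero (by norm_num) hy0)) ?_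
    simp
    field_simp
    ring
  · refine HasDerivAt.congr_deriv
      (((h (Fin.last m)).log hy0).const_mul (1 / 4)) ?_
    simp
    field_simp

lemma fderiv_fderiv_hyperbolicPotential_apply {y : Fin (m + 1) → ℝ} (hy : 0 < y (Fin.last m))
    (a b : Fin (m + 1) → ℝ) :
    fderiv ℝ (fderiv ℝ hyperbolicPotential) y a b =
      ∑ i : Fin m, (a i.castSucc - y i.castSucc * a (Fin.last m) / y (Fin.last m))
        * (b i.castSucc - y i.castSucc * b (Fin.last m) / y (Fin.last m)) / (4 * y (Fin.last m))
        + a (Fin.last m) * b (Fin.last m) / (4 * y (Fin.last m) ^ 2) := by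
  have hd : DifferentiableAt ℝ (fderiv ℝ hyperbolicPotential) y :=
    ((contDiffAt_hyperbolicPotential hy).fderiv_right (m := 1) (by norm_num)).differentiableAt
      (by norm_num)
  have hd' : DifferentiableAt ℝ (fun z => fderiv ℝ hyperbolicPotential z b) y :=
    hd.clm_apply (differentiableAt_const b)
  have happly : fderiv ℝ (fderiv ℝ hyperbolicPotential) y a b =
      fderiv ℝ (fun z => fderiv ℝ hyperbolicPotential z b) y a := by
    rw [fderiv_clm_apply hd (differentiableAt_const b)]
    simp
  have h := hasDerivAt_apply_add_smul y a
  have hy0 : (y + (0 : ℝ) • a) (Fin.last m) ≠ 0 := by simpa using hy.ne'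
  have hpos : ∀ᶠ s : ℝ in nhds 0, 0 < (y + s • a) (Fin.last m) :=
    (h (Fin.last m)).continuousAt.eventually_const_lt (by simpa using hy)
  rw [happly, ← hd'.lineDeriv_eq_fderiv]
  refine HasDerivAt.deriv (HasDerivAt.congr_of_eventuallyEq ?_
    (hpos.mono fun s hs => fderiv_hyperbolicPotential_apply hs b))
  rw [← sub_neg_eq_add]
  refine HasDerivAt.sub (HasDerivAt.fun_sum fun i _ => ?_) ?_
  · refine HasDerivAt.congr_deriv
      ((((h i.castSucc).mul_const (b i.castSucc)).fun_div ((h (Fin.last m)).const_mul 4)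
      (mul_ne_zero (by norm_num) hy0)).fun_sub
      ((((h i.castSucc).fun_pow 2).mul_const (b (Fin.last m))).fun_div
        (((h (Fin.last m)).fun_pow 2).const_mul 8)
        (mul_ne_zero (by norm_num) (pow_ne_zero 2 hy0)))) ?_
    simp
    field_simp
    ring
  · refine HasDerivAt.congr_deriv
      ((hasDerivAt_const (0 : ℝ) (b (Fin.last m))).fun_div ((h (Fin.last m)).const_mul 4)
      (mul_ne_zero (by norm_num) hy0)) ?_
    simp
    field_simp

lemma differentiableAt_hyperbolicAffineCoord {x : Fin (m + 1) → ℝ} (hx : 0 < x (Fin.last m)) :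
    DifferentiableAt ℝ hyperbolicAffineCoord x := by
  have hx0 : x (Fin.last m) ^ 2 ≠ 0 := by positivity
  rw [differentiableAt_pi]
  intro i
  unfold hyperbolicAffineCoord
  split_ifs <;> fun_prop (disch := assumption)

lemma fderiv_hyperbolicAffineCoord_apply {x : Fin (m + 1) → ℝ} (hx : 0 < x (Fin.last m))
    (v : Fin (m + 1) → ℝ) :
    fderiv ℝ hyperbolicAffineCoord x v = fun i =>
      if i = Fin.last m then -2 * v (Fin.last m) / x (Fin.last m) ^ 3
      else 2 * v i / x (Fin.last m) ^ 2 - 4 * x i * v (Fin.last m) / x (Fin.last m) ^ 3 := by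
  rw [← (differentiableAt_hyperbolicAffineCoord hx).lineDeriv_eq_fderiv]
  refine HasDerivAt.deriv (hasDerivAt_pi.2 fun i => ?_)
  have h := hasDerivAt_apply_add_smul x v
  have hx0 : (x + (0 : ℝ) • v) (Fin.last m) ^ 2 ≠ 0 := by simpa using hx.ne'
  unfold hyperbolicAffineCoord
  split_ifs
  · refine HasDerivAt.congr_deriv
      ((hasDerivAt_const (0 : ℝ) (1 : ℝ)).fun_div ((h (Fin.last m)).fun_pow 2) hx0) ?_
    simp
    field_simp
  · refine HasDerivAt.congr_deriv
      (((h i).const_mul 2).fun_div ((h (Fin.last m)).fun_pow 2) hx0) ?_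
    simp
    field_simp
    ring

end HessianPotential

/-- The hyperbolic metric `(dx₁² + ⋯ + dxₙ²)/xₙ²` on the upper half space
(here of dimension `n = m + 1 ≥ 2`) is the Hessian quadratic form of
`φ(y) = (y₁² + ⋯ + y_{n−1}²)/(8yₙ) − (1/4)·log yₙ` in the affine coordinates
`yᵢ = 2xᵢ/xₙ²` (for `i < n`), `yₙ = 1/xₙ²`. -/
theorem stmt2 (m : ℕ) (hm : 1 ≤ m)
    (Ψ : (Fin (m + 1) → ℝ) → (Fin (m + 1) → ℝ))
    (hΨ : ∀ (x : Fin (m + 1) → ℝ) (i : Fin (m + 1)),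
      Ψ x i = if i = Fin.last m then 1 / (x (Fin.last m)) ^ 2
              else 2 * x i / (x (Fin.last m)) ^ 2)
    (φ : (Fin (m + 1) → ℝ) → ℝ)
    (hφ : ∀ y : Fin (m + 1) → ℝ,
      φ y = (∑ i : Fin (m + 1), if i = Fin.last m then (0 : ℝ) else (y i) ^ 2)
              / (8 * y (Fin.last m)) - (1 / 4) * Real.log (y (Fin.last m))) :
    ∀ x : Fin (m + 1) → ℝ, 0 < x (Fin.last m) → ∀ v w : Fin (m + 1) → ℝ,
      fderiv ℝ (fderiv ℝ φ) (Ψ x) (fderiv ℝ Ψ x v) (fderiv ℝ Ψ x w)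
        = (∑ i : Fin (m + 1), v i * w i) / (x (Fin.last m)) ^ 2 := by
  obtain rfl : Ψ = hyperbolicAffineCoord := funext₂ hΨ
  obtain rfl : φ = hyperbolicPotential := by
    ext y
    simp [hφ, hyperbolicPotential, Fin.sum_univ_castSucc, Fin.castSucc_ne_last, Finset.sum_div]
  intro x hx v w
  have hy : 0 < hyperbolicAffineCoord x (Fin.last m) := by
    simp only [hyperbolicAffineCoord, if_true]
    positivity
  rw [fderiv_fderiv_hyperbolicPotential_apply hy, fderiv_hyperbolicAffineCoord_apply hx,
    fderiv_hyperbolicAffineCoord_apply hx, Fin.sum_univ_castSucc, add_div, Finset.sum_div]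
  simp only [hyperbolicAffineCoord, if_true, Fin.castSucc_ne_last, if_false]
  congr 1
  · refine Finset.sum_congr rfl fun i _ => ?_
    field_simp
    ring
  · field_simp
    ring
end

section
/- Let Ω ⊆ ℝ² be open and let x : ℝ² → ℝ³ be differentiable on Ω with x(q) ≠ 0 for all q ∈ Ω, where ℝ³ carries the Euclidean norm. Define γ : Ω → ℝ³ by γ(q) := x(q)/‖x(q)‖. Suppose that at a point p ∈ Ω the three vectors x(p), ∂_u x(p), ∂_v x(p) are linearly dependent over ℝ, where ∂_u, ∂_v denote the partial derivatives in the two coordinate directions of ℝ². Then ∂_u γ(p) × ∂_v γ(p) = 0, where × is the cross product on ℝ³. (This is the computational core of the lemma that a regular surface in ℝ³ not passing through the origin, whose position vector is everywhere linearly dependent with its partial derivatives, lies on a cone with apex the origin.) -/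
/-- A vector of `ℝ³` orthogonal to, and having zero cross product with, a nonzero vector is zero. -/
lemma eq_zero_of_dotProduct_eq_zero_of_crossProduct_eq_zero {x n : Fin 3 → ℝ} (hx : x ≠ 0)
    (hdot : x ⬝ᵥ n = 0) (hcross : crossProduct x n = 0) : n = 0 := by
  have h := cross_cross_eq_smul_sub_smul' x x n
  rw [hcross, hdot, map_zero, zero_smul, zero_sub, eq_comm, neg_eq_zero] at h
  exact (smul_eq_zero.mp h).resolve_left (dotProduct_self_eq_zero.not.mpr hx)

/-- Two vectors orthogonal to `x ≠ 0` that agree, up to scaling by `c` and multiples of `x`, with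
vectors linearly dependent with `x`, have zero cross product. -/
lemma crossProduct_eq_zero_of_not_linearIndependent {x a b : Fin 3 → ℝ} {c α β : ℝ} (hx : x ≠ 0)
    (hdep : ¬ LinearIndependent ℝ ![x, a, b])
    (ha : x ⬝ᵥ (c • a + α • x) = 0) (hb : x ⬝ᵥ (c • b + β • x) = 0) :
    crossProduct (c • a + α • x) (c • b + β • x) = 0 := by
  refine eq_zero_of_dotProduct_eq_zero_of_crossProduct_eq_zero hx ?_ ?_
  · have hdet : Matrix.det ![x, a, b] = 0 := by
      by_contra h
      exact hdep (Matrix.linearIndependent_rows_of_det_ne_zero h)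
    rw [← triple_product_eq_det] at hdet
    simp only [map_add, map_smul, LinearMap.add_apply, LinearMap.smul_apply, cross_self,
      dotProduct_add, dotProduct_smul, dot_self_cross, dot_cross_self, hdet, smul_zero, add_zero]
  · rw [cross_cross_eq_smul_sub_smul', hb, dotProduct_comm, ha, zero_smul, zero_smul, sub_zero]

/-- The derivative of the radial projection `x / ‖x‖` is a multiple of the derivative of `x`
up to multiples of `x`, and is orthogonal to `x`. -/
lemma exists_fderiv_normalize_eq {E : Type*} [NormedAddCommGroup E] [NormedSpace ℝ E]
    {x : E → Fin 3 → ℝ} {p : E} (hx : DifferentiableAt ℝ x p) (hx0 : x p ≠ 0) :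
    ∃ (c : ℝ) (α : E → ℝ), ∀ v,
      fderiv ℝ (fun q => (Real.sqrt (∑ i : Fin 3, (x q i) ^ 2))⁻¹ • x q) p v
        = c • fderiv ℝ x p v + α v • x p ∧
      x p ⬝ᵥ (c • fderiv ℝ x p v + α v • x p) = 0 := by
  have hs : 0 < ∑ i : Fin 3, (x p i) ^ 2 := by
    obtain ⟨i, hi⟩ := Function.ne_iff.mp hx0
    exact Finset.sum_pos' (fun j _ => sq_nonneg _) ⟨i, Finset.mem_univ i, sq_pos_of_ne_zero hi⟩
  set s : ℝ := ∑ i : Fin 3, (x p i) ^ 2 with hsdef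
  have hd : HasFDerivAt (fun q => ∑ i : Fin 3, (x q i) ^ 2)
      (∑ i : Fin 3, (2 * x p i) • (ContinuousLinearMap.proj i).comp (fderiv ℝ x p)) p := by
    refine HasFDerivAt.fun_sum fun i _ => ?_
    simpa using ((hasFDerivAt_pi'.mp hx.hasFDerivAt) i).pow 2
  have hr : 0 < Real.sqrt s := Real.sqrt_pos.mpr hs
  have hg := (hasDerivAt_inv hr.ne').comp_hasFDerivAt p (hd.sqrt hs.ne')
  have hγ := hg.smul hx.hasFDerivAt
  refine ⟨(Real.sqrt s)⁻¹, fun v => -(Real.sqrt s)⁻¹ * (x p ⬝ᵥ fderiv ℝ x p v) / s,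
    fun v => ⟨?_, ?_⟩⟩
  · refine (congrArg (fun L => L v) hγ.fderiv).trans ?_
    simp only [Function.comp_apply, ← hsdef, Real.sq_sqrt hs.le, add_apply, smul_apply,
      ContinuousLinearMap.smulRight_apply, sum_apply,
      ContinuousLinearMap.comp_apply, ContinuousLinearMap.proj_apply, smul_eq_mul, dotProduct]
    simp only [Fin.sum_univ_three]
    congr 2
    field_simp
  · have hxx : x p ⬝ᵥ x p = s := by simp [hsdef, dotProduct, sq]
    rw [dotProduct_add, dotProduct_smul, dotProduct_smul, hxx, smul_eq_mul, smul_eq_mul]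
    field_simp
    ring

/-- If the position vector `x(p)` of a surface in `ℝ³` (not passing through the
origin) is linearly dependent with its two partial derivatives at `p`, then the
Gauss-type map `γ = x/‖x‖` (Euclidean norm) satisfies `∂_u γ(p) × ∂_v γ(p) = 0`. -/
theorem stmt7 (Ω : Set (ℝ × ℝ)) (hΩ : IsOpen Ω)
    (x : (ℝ × ℝ) → (Fin 3 → ℝ))
    (hx : ∀ q ∈ Ω, DifferentiableAt ℝ x q)
    (hx0 : ∀ q ∈ Ω, x q ≠ 0)
    (γ : (ℝ × ℝ) → (Fin 3 → ℝ))
    (hγ : ∀ q : ℝ × ℝ, γ q = (Real.sqrt (∑ i : Fin 3, (x q i) ^ 2))⁻¹ • x q)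
    (p : ℝ × ℝ) (hp : p ∈ Ω)
    (hdep : ¬ LinearIndependent ℝ
      ![x p, fderiv ℝ x p ((1 : ℝ), (0 : ℝ)), fderiv ℝ x p ((0 : ℝ), (1 : ℝ))]) :
    crossProduct (fderiv ℝ γ p ((1 : ℝ), (0 : ℝ))) (fderiv ℝ γ p ((0 : ℝ), (1 : ℝ))) = 0 := by
  obtain rfl : γ = fun q => (Real.sqrt (∑ i : Fin 3, (x q i) ^ 2))⁻¹ • x q := funext hγ
  obtain ⟨c, α, h⟩ := exists_fderiv_normalize_eq (hx p hp) (hx0 p hp)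
  rw [(h _).1, (h _).1]
  exact crossProduct_eq_zero_of_not_linearIndependent (hx0 p hp) hdep (h _).2 (h _).2
end

section
/- Let ℍ² := {(x,y) ∈ ℝ² : y > 0} and define f : ℍ² → ℝ by f(x,y) := x²/(2y) + (1/4)·y·log(y). Define Ψ : (0,∞) × ℝ → ℝ² by Ψ(r,θ) := (r²·θ, r²), which takes values in ℍ². Then for every (r,θ) ∈ (0,∞) × ℝ and all tangent vectors (a,s), (b,t) ∈ ℝ², D²f(Ψ(r,θ))( DΨ(r,θ)(a,s), DΨ(r,θ)(b,t) ) = a·b + r²·s·t. (That is, the coordinate change (x,y) = (r²θ, r²) brings the Hessian quadratic form f_xx dx² + 2 f_xy dx dy + f_yy dy² of f into the flat Euclidean metric dr² + r² dθ² in polar coordinates; f is an exotic Hessian potential for the flat plane.) -/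
open ContinuousLinearMap in
theorem hasFDerivAt_hessianPotential {p : ℝ × ℝ} (hp : 0 < p.2) :
    HasFDerivAt (fun p : ℝ × ℝ => p.1 ^ 2 / (2 * p.2) + (1 / 4) * p.2 * Real.log p.2)
      ((p.1 / p.2) • fst ℝ ℝ ℝ +
        (-(p.1 ^ 2 / (2 * p.2 ^ 2)) + (Real.log p.2 + 1) / 4) • snd ℝ ℝ ℝ) p := by
  have h1 : HasFDerivAt Prod.fst (fst ℝ ℝ ℝ) p := hasFDerivAt_fst
  have h2 : HasFDerivAt Prod.snd (snd ℝ ℝ ℝ) p := hasFDerivAt_snd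
  have hy : p.2 ≠ 0 := hp.ne'
  refine ((((h1.pow 2).mul ((hasDerivAt_inv (mul_ne_zero two_ne_zero hy)).comp_hasFDerivAt p
    (h2.const_mul 2))).add ((h2.const_mul (1 / 4)).mul (h2.log hy))).congr_fderiv ?_)
    |>.congr_of_eventuallyEq (.of_forall fun q => by simp [div_eq_mul_inv])
  ext <;> simp <;> field_simp
  ring

open ContinuousLinearMap in
theorem hasFDerivAt_gradient_hessianPotential {p : ℝ × ℝ} (hp : 0 < p.2) :
    HasFDerivAt (fun p : ℝ × ℝ => (p.1 / p.2) • fst ℝ ℝ ℝ +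
        (-(p.1 ^ 2 / (2 * p.2 ^ 2)) + (Real.log p.2 + 1) / 4) • snd ℝ ℝ ℝ)
      (((1 / p.2) • fst ℝ ℝ ℝ + (-(p.1 / p.2 ^ 2)) • snd ℝ ℝ ℝ).smulRight (fst ℝ ℝ ℝ) +
        ((-(p.1 / p.2 ^ 2)) • fst ℝ ℝ ℝ +
          (p.1 ^ 2 / p.2 ^ 3 + 1 / (4 * p.2)) • snd ℝ ℝ ℝ).smulRight (snd ℝ ℝ ℝ)) p := by
  have h1 : HasFDerivAt Prod.fst (fst ℝ ℝ ℝ) p := hasFDerivAt_fst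
  have h2 : HasFDerivAt Prod.snd (snd ℝ ℝ ℝ) p := hasFDerivAt_snd
  have hy : p.2 ≠ 0 := hp.ne'
  have hfst : HasFDerivAt (fun p : ℝ × ℝ => p.1 / p.2)
      ((1 / p.2) • fst ℝ ℝ ℝ + (-(p.1 / p.2 ^ 2)) • snd ℝ ℝ ℝ) p := by
    refine ((h1.mul ((hasDerivAt_inv hy).comp_hasFDerivAt p h2)).congr_fderiv ?_)
      |>.congr_of_eventuallyEq (.of_forall fun q => by simp [div_eq_mul_inv])
    ext <;> simp <;> field_simp
  have hsnd : HasFDerivAt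
      (fun p : ℝ × ℝ => -(p.1 ^ 2 / (2 * p.2 ^ 2)) + (Real.log p.2 + 1) / 4)
      ((-(p.1 / p.2 ^ 2)) • fst ℝ ℝ ℝ +
        (p.1 ^ 2 / p.2 ^ 3 + 1 / (4 * p.2)) • snd ℝ ℝ ℝ) p := by
    refine ((((h1.pow 2).mul ((hasDerivAt_inv (mul_ne_zero two_ne_zero
      (pow_ne_zero 2 hy))).comp_hasFDerivAt p ((h2.pow 2).const_mul 2))).neg.add
      (((h2.log hy).add_const 1).mul_const (1 / 4))).congr_fderiv ?_)
      |>.congr_of_eventuallyEq (.of_forall fun q => by simp [div_eq_mul_inv])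
    ext <;> simp <;> field_simp
  exact (hfst.smul_const (fst ℝ ℝ ℝ)).add (hsnd.smul_const (snd ℝ ℝ ℝ))

open ContinuousLinearMap in
theorem hasFDerivAt_polarChange (q : ℝ × ℝ) :
    HasFDerivAt (fun q : ℝ × ℝ => (q.1 ^ 2 * q.2, q.1 ^ 2))
      (((2 * q.1 * q.2) • fst ℝ ℝ ℝ + (q.1 ^ 2) • snd ℝ ℝ ℝ).prod
        ((2 * q.1) • fst ℝ ℝ ℝ)) q := by
  have h1 : HasFDerivAt Prod.fst (fst ℝ ℝ ℝ) q := hasFDerivAt_fst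
  have h2 : HasFDerivAt Prod.snd (snd ℝ ℝ ℝ) q := hasFDerivAt_snd
  refine (((h1.pow 2).mul h2).prodMk (h1.pow 2)).congr_fderiv ?_
  ext <;> simp
  ring

/-- The coordinate change `(x,y) = (r²θ, r²)` brings the Hessian quadratic form of
`f(x,y) = x²/(2y) + (1/4)·y·log y` on the upper half plane into the flat Euclidean
metric `dr² + r² dθ²` in polar coordinates. -/
theorem stmt13 (f : ℝ × ℝ → ℝ)
    (hf : ∀ p : ℝ × ℝ, f p = p.1 ^ 2 / (2 * p.2) + (1 / 4) * p.2 * Real.log p.2)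
    (Ψ : ℝ × ℝ → ℝ × ℝ)
    (hΨ : ∀ q : ℝ × ℝ, Ψ q = (q.1 ^ 2 * q.2, q.1 ^ 2)) :
    ∀ (r θ : ℝ), 0 < r → ∀ (a s b t : ℝ),
      fderiv ℝ (fderiv ℝ f) (Ψ (r, θ))
          (fderiv ℝ Ψ (r, θ) (a, s)) (fderiv ℝ Ψ (r, θ) (b, t))
        = a * b + r ^ 2 * s * t := by
  intro r θ hr a s b t
  obtain rfl : f = _ := funext hf
  obtain rfl : Ψ = _ := funext hΨ
  have hpos : (0 : ℝ) < ((r ^ 2 * θ, r ^ 2) : ℝ × ℝ).2 := pow_pos hr 2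
  have hgrad := (hasFDerivAt_gradient_hessianPotential hpos).congr_of_eventuallyEq
    ((continuousAt_snd.eventually (lt_mem_nhds hpos)).mono
      fun p hp => (hasFDerivAt_hessianPotential hp).fderiv)
  rw [(hasFDerivAt_polarChange (r, θ)).fderiv, hgrad.fderiv]
  simp
  field_simp
  ring
end
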